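/- Let p ≥ 3 be a prime such that the integer (2p+9)(2p−3)(8p−13) is squarefree. Then the polynomial G(x) = x⁸ + 3x⁶ + (2p+1)·x⁴ + 3x² + 1 is monogenic and its Galois group Gal(G) is isomorphic to the wreath product (ℤ/2ℤ × ℤ/2ℤ) ≀ ℤ/2ℤ, that is, to the semidirect product ((ℤ/2ℤ × ℤ/2ℤ) × (ℤ/2ℤ × ℤ/2ℤ)) ⋊ ℤ/2ℤ in which the nontrivial element of ℤ/2ℤ acts by swapping the two direct factors. -/

import Mathlib

open Polynomial

/-- A monic polynomial `f ∈ ℤ[x]` is *monogenic* if it is irreducible over `ℚ` and,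
for any number field `K` generated over `ℚ` by a root `θ` of `f`, the ring `ℤ[θ]`
is the full ring of integers (the integral closure of `ℤ`) of `K`. -/
def IsMonogenic (f : Polynomial ℤ) : Prop :=
  f.Monic ∧ Irreducible (f.map (Int.castRingHom ℚ)) ∧
    ∀ (K : Type) [Field K] [NumberField K] (θ : K),
      Polynomial.aeval θ f = 0 →
      Algebra.adjoin ℚ {θ} = (⊤ : Subalgebra ℚ K) →
      Algebra.adjoin ℤ {θ} = integralClosure ℤ K

/-- The Klein four-group `ℤ/2 × ℤ/2`, written multiplicatively. -/
abbrev KleinFour : Type := Multiplicative (ZMod 2) × Multiplicative (ZMod 2)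

section

open IntermediateField

theorem exists_eq_add_mul_of_mem_sup_adjoin {K : Type*} [Field K] [Algebra ℚ K]
    (E : IntermediateField ℚ K) {x τ n : K} (hτ : τ ∈ E)
    (hn : n ∈ E) (hx : x ^ 2 = τ * x - n) {α : K} (hα : α ∈ E ⊔ ℚ⟮x⟯) :
    ∃ s ∈ E, ∃ t ∈ E, α = s + t * x := by
  rw [← restrictScalars_adjoin_eq_sup, mem_restrictScalars, ← mem_toSubalgebra] at hα
  have hintegral : IsIntegral E x := by
    refine ⟨X ^ 2 - C (⟨τ, hτ⟩ : E) * X + C (⟨n, hn⟩ : E), by monicity!, ?_⟩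
    simp [IntermediateField.algebraMap_apply, hx]
  rw [adjoin_simple_toSubalgebra_of_isAlgebraic hintegral.isAlgebraic] at hα
  induction hα using Algebra.adjoin_induction with
  | mem y hy =>
    rw [Set.mem_singleton_iff] at hy
    exact ⟨0, E.zero_mem, 1, E.one_mem, by simp [hy]⟩
  | algebraMap r => exact ⟨r, r.2, 0, E.zero_mem, by simp [IntermediateField.algebraMap_apply]⟩
  | add y w _ _ hy hw =>
    obtain ⟨a, ha, b, hb, rfl⟩ := hy
    obtain ⟨c, hc, d, hd, rfl⟩ := hw
    exact ⟨a + c, E.add_mem ha hc, b + d, E.add_mem hb hd, by ring⟩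
  | mul y w _ _ hy hw =>
    obtain ⟨a, ha, b, hb, rfl⟩ := hy
    obtain ⟨c, hc, d, hd, rfl⟩ := hw
    exact ⟨a * c - b * d * n, by apply_rules [sub_mem, mul_mem],
      a * d + b * c + b * d * τ, by apply_rules [add_mem, mul_mem],
      by linear_combination b * d * hx⟩

theorem eq_zero_of_add_mul_eq_zero {K : Type*} [Field K] [Algebra ℚ K] (E : IntermediateField ℚ K)
    {x s t : K} (hx : x ∉ E) (hs : s ∈ E) (ht : t ∈ E)
    (h : s + t * x = 0) : s = 0 ∧ t = 0 := by
  have ht0 : t = 0 := by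
    by_contra h0
    apply hx
    have : x = - s / t := by field_simp; linear_combination h
    rw [this]
    exact E.div_mem (E.neg_mem hs) ht
  subst ht0
  simpa using h

theorem mem_or_mul_mem {K : Type*} [Field K] [CharZero K] [Algebra ℚ K] (E : IntermediateField ℚ K)
    {x t : K}
    (hx : x ^ 2 ∈ E) (ht : t ^ 2 ∈ E) (h : t ∈ E ⊔ ℚ⟮x⟯) : t ∈ E ∨ x * t ∈ E := by
  by_cases hxE : x ∈ E
  · left
    rwa [sup_eq_left.2 (by simpa using hxE)] at h
  obtain ⟨a, ha, b, hb, rfl⟩ := exists_eq_add_mul_of_mem_sup_adjoin E (x := x) (τ := 0)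
    (n := - x ^ 2) E.zero_mem (E.neg_mem hx) (by ring) h
  have := (eq_zero_of_add_mul_eq_zero E hxE (s := a ^ 2 + b ^ 2 * x ^ 2 - (a + b * x) ^ 2)
    (t := 2 * a * b)
    (by apply_rules [sub_mem, add_mem, mul_mem, pow_mem]) (mul_mem (mul_mem (ofNat_mem E 2) ha) hb)
      (by ring)).2
  simp at this
  rcases this with rfl | rfl
  · right
    convert E.mul_mem hb hx using 1
    ring
  · left; simpa

theorem finrank_sup_adjoin_of_quadratic {K : Type*} [Field K] [Algebra ℚ K]
    (E : IntermediateField ℚ K) {x τ n : K} (hτ : τ ∈ E)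
    (hn : n ∈ E) (hx : x ^ 2 = τ * x - n) (hxE : x ∉ E) :
    Module.finrank ℚ ↥(E ⊔ ℚ⟮x⟯) = 2 * Module.finrank ℚ E := by
  rw [← restrictScalars_adjoin_eq_sup]
  set f : E[X] := X ^ 2 - C (⟨τ, hτ⟩ : E) * X + C (⟨n, hn⟩ : E) with hf
  have hmonic : f.Monic := by rw [hf]; monicity!
  have hroot : aeval x f = 0 := by simp [hf, IntermediateField.algebraMap_apply, hx]
  have hintegral : IsIntegral E x := ⟨f, hmonic, hroot⟩
  have h2 : Module.finrank E E⟮x⟯ = 2 := by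
    rw [adjoin.finrank hintegral]
    apply le_antisymm
    · refine (natDegree_le_of_dvd (minpoly.dvd _ _ hroot) hmonic.ne_zero).trans ?_
      rw [hf]
      compute_degree
    · rw [minpoly.two_le_natDegree_iff hintegral]
      rintro ⟨y, rfl⟩
      exact hxE y.2
  have := Module.finrank_mul_finrank ℚ E E⟮x⟯
  rw [h2] at this
  rw [mul_comm, this]
  rfl

theorem finrank_sup_adjoin_list {K : Type*} [Field K] [CharZero K] [Algebra ℚ K] (l : List K) :
    ∀ (E : IntermediateField ℚ K) (_ : ∀ x ∈ l, x ^ 2 ∈ E)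
    (_ : ∀ l' : List K, l'.Sublist l → l' ≠ [] → l'.prod ∉ E),
    Module.finrank ℚ ↥(E ⊔ adjoin ℚ {x | x ∈ l}) = 2 ^ l.length * Module.finrank ℚ E := by
  induction l with
  | nil =>
    intro E _ _
    have : {x : K | x ∈ ([] : List K)} = ∅ := by ext; simp
    rw [this, adjoin_empty, sup_bot_eq]
    simp
  | cons a l ih =>
    intro E hsq hp
    have hsup : E ⊔ adjoin ℚ {x | x ∈ a :: l} = (E ⊔ ℚ⟮a⟯) ⊔ adjoin ℚ {x | x ∈ l} := by
      rw [sup_assoc, ← adjoin_union]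
      congr 2
      ext
      simp
    have hle : E ≤ E ⊔ ℚ⟮a⟯ := le_sup_left
    have ha : a ∉ E := by simpa using hp [a] (by simp) (by simp)
    have hmem : ∀ l' : List K, l'.Sublist l → l'.prod ^ 2 ∈ E := by
      intro l' hl'
      have h : ∀ y ∈ l', y ^ 2 ∈ E := fun y hy => hsq y (by simp [hl'.subset hy])
      clear hl'
      induction l' with
      | nil => simp
      | cons b l' ih' =>
        rw [List.prod_cons, mul_pow]
        exact mul_mem (h b (by simp)) (ih' fun y hy => h y (by simp [hy]))
    rw [hsup, ih (E ⊔ ℚ⟮a⟯) (fun x hx => hle (hsq x (by simp [hx]))),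
      finrank_sup_adjoin_of_quadratic E (τ := 0)
      (n := - a ^ 2) (zero_mem _) (neg_mem (hsq a (by simp))) (by ring) ha]
    · simp [pow_succ]; ring
    · intro l' hl' hne hmem'
      rcases mem_or_mul_mem E (hsq a (by simp)) (hmem l' hl') hmem' with h | h
      · exact hp l' (hl'.cons a) hne h
      · exact hp (a :: l') (hl'.cons_cons a) (by simp) (by simpa using h)

theorem isIntegral_conj {K : Type*} [Field K] [Algebra ℚ K] (E : IntermediateField ℚ K)
    {x τ n s t : K} (hxE : x ∉ E) (hτ : τ ∈ E)
    (hn : n ∈ E) (hx : x ^ 2 = τ * x - n) (hs : s ∈ E) (ht : t ∈ E) (h : IsIntegral ℤ (s + t * x)) :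
    IsIntegral ℤ (s + t * (τ - x)) := by
  obtain ⟨m, hm, hm0⟩ := h
  refine ⟨m, hm, ?_⟩
  have key : ∀ m : ℤ[X], ∃ e ∈ E, ∃ f ∈ E, aeval (s + t * x) m = e + f * x ∧
      aeval (s + t * (τ - x)) m = e + f * (τ - x) := by
    intro m
    induction m using Polynomial.induction_on with
    | C a => exact ⟨a, by simp, 0, E.zero_mem, by simp, by simp⟩
    | add p q hp hq =>
      obtain ⟨a, ha, b, hb, h1, h2⟩ := hp
      obtain ⟨c, hc, d, hd, h3, h4⟩ := hq
      exact ⟨a + c, E.add_mem ha hc, b + d, E.add_mem hb hd,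
        by rw [map_add, h1, h3]; ring, by rw [map_add, h2, h4]; ring⟩
    | monomial k c ih =>
      obtain ⟨a, ha, b, hb, h1, h2⟩ := ih
      refine ⟨a * s - b * t * n, by apply_rules [sub_mem, mul_mem],
        a * t + b * s + b * t * τ, by apply_rules [add_mem, mul_mem], ?_, ?_⟩
      · rw [pow_succ, ← mul_assoc, map_mul, h1, aeval_X]
        linear_combination b * t * hx
      · rw [pow_succ, ← mul_assoc, map_mul, h2, aeval_X]
        linear_combination b * t * hx
  obtain ⟨e, he, f, hf, h1, h2⟩ := key m
  rw [← aeval_def] at hm0 ⊢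
  rw [hm0] at h1
  obtain ⟨rfl, rfl⟩ := eq_zero_of_add_mul_eq_zero E hxE he hf h1.symm
  simpa using h2

theorem isIntegral_of_sq_mul_of_radical {K : Type*} [Field K] (E : Subfield K) {d t : K}
    (hd : d ∈ E) (hdi : IsIntegral ℤ d) (hd0 : d ≠ 0)
    (hrad : ∀ w ∈ E, ∀ c ∈ E, IsIntegral ℤ w → IsIntegral ℤ c → w ^ 2 = d * c → ∃ c' : K,
      IsIntegral ℤ c' ∧ w = d * c')
    (ht : t ∈ E) (h : IsIntegral ℤ (t ^ 2 * d)) : IsIntegral ℤ t := by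
  have h1 : IsIntegral ℤ (d * t) := by
    refine IsIntegral.of_pow (n := 2) (by norm_num) ?_
    rw [show (d * t) ^ 2 = d * (t ^ 2 * d) by ring]
    exact hdi.mul h
  obtain ⟨c', hc', h2⟩ := hrad (d * t) (E.mul_mem hd ht) (t ^ 2 * d) (E.mul_mem (pow_mem ht 2) hd)
    h1 h (by ring)
  rwa [mul_left_cancel₀ hd0 h2]

theorem isIntegral_of_quadratic {K : Type*} [Field K] {z τ n : K} (hτ : IsIntegral ℤ τ)
    (hn : IsIntegral ℤ n) (hz : z ^ 2 = τ * z - n) :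
    IsIntegral ℤ z := by
  refine isIntegral_trans (R := ℤ) (A := integralClosure ℤ K) z
    ⟨X ^ 2 - C ⟨τ, hτ⟩ * X + C ⟨n, hn⟩, by monicity!, ?_⟩
  simp [hz]

theorem exists_integral_coords {K : Type*} [Field K] [CharZero K] [Algebra ℚ K]
    (E : IntermediateField ℚ K) {x τ n : K} (hxE : x ∉ E) (hτ : τ ∈ E)
    (hn : n ∈ E) (hτi : IsIntegral ℤ τ) (hni : IsIntegral ℤ n) (hx : x ^ 2 = τ * x - n)
    (hrad : ∀ w ∈ E, ∀ c ∈ E, IsIntegral ℤ w → IsIntegral ℤ c → w ^ 2 = (τ ^ 2 - 4 * n) * c →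
      ∃ c' : K, IsIntegral ℤ c' ∧ w = (τ ^ 2 - 4 * n) * c')
    {α : K} (hα : α ∈ E ⊔ ℚ⟮x⟯) (hi : IsIntegral ℤ α) :
    ∃ s ∈ E, ∃ t ∈ E, IsIntegral ℤ s ∧ IsIntegral ℤ t ∧ α = s + t * x := by
  obtain ⟨s, hs, t, ht, rfl⟩ := exists_eq_add_mul_of_mem_sup_adjoin E hτ hn hx hα
  have hc := isIntegral_conj E hxE hτ hn hx hs ht hi
  have h4 : (4 : K) ∈ E := ofNat_mem E 4
  have h2 : (2 : K) ∈ E := ofNat_mem E 2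
  have h4i : IsIntegral ℤ (4 : K) := by simpa using isIntegral_algebraMap (R := ℤ) (A := K) (x := 4)
  have hti : IsIntegral ℤ t := by
    refine isIntegral_of_sq_mul_of_radical E.toSubfield (d := τ ^ 2 - 4 * n)
      (E.sub_mem (pow_mem hτ 2) (E.mul_mem h4 hn)) ((hτi.pow 2).sub (h4i.mul hni)) ?_ hrad ht ?_
    · intro h0
      have : (2 * x - τ) ^ 2 = 0 := by linear_combination 4 * hx + h0
      apply hxE
      have : x = τ / 2 := by
        have := pow_eq_zero_iff (two_ne_zero) |>.1 this
        linear_combination this / 2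
      rw [this]
      exact E.div_mem hτ h2
    · rw [show t ^ 2 * (τ ^ 2 - 4 * n) = (s + t * x - (s + t * (τ - x))) ^ 2 by
        linear_combination - 4 * t ^ 2 * hx]
      exact (hi.sub hc).pow 2
  refine ⟨s, hs, t, ht, ?_, hti, rfl⟩
  rw [show s = s + t * x - t * x by ring]
  exact hi.sub (hti.mul (isIntegral_of_quadratic hτi hni hx))

theorem Squarefree.sq_ne_ratCast {n : ℤ} (hn : Squarefree n) (h1 : 1 < n) (r : ℚ) : r ^ 2 ≠ n := by
  intro h
  have hs : IsSquare ((n : ℤ) : ℚ) := ⟨r, by rw [← h, sq]⟩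
  rw [Rat.isSquare_intCast_iff] at hs
  obtain ⟨m, rfl⟩ := hs
  rcases Int.isUnit_iff.1 (hn m dvd_rfl) with rfl | rfl <;> simp at h1

theorem exists_rat_of_mem_adjoin {K : Type*} [Field K] [Algebra ℚ K] {z q : K}
    (hq : q ∈ (⊥ : IntermediateField ℚ K)) (hz : z ^ 2 + 3 * z + q = 0) {t : K} (ht : t ∈ ℚ⟮z⟯) :
    ∃ e f : ℚ, t = e + f * z := by
  rw [← bot_sup_eq ℚ⟮z⟯] at ht
  obtain ⟨e, he, f, hf, rfl⟩ := exists_eq_add_mul_of_mem_sup_adjoin ⊥ (τ := -3) (n := q)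
    (neg_mem (ofNat_mem _ 3)) hq (by linear_combination hz) ht
  obtain ⟨e, rfl⟩ := mem_bot.1 he
  obtain ⟨f, rfl⟩ := mem_bot.1 hf
  exact ⟨e, f, by simp⟩

theorem notMem_bot_of_quadratic {K : Type*} [Field K] [CharZero K] [Algebra ℚ K] {p : ℕ}
    (hp : 3 ≤ p) {z : K} (hz : z ^ 2 + 3 * z + (2 * p - 1) = 0) :
    z ∉ (⊥ : IntermediateField ℚ K) := by
  rintro h
  obtain ⟨e, rfl⟩ := mem_bot.1 h
  have h1 : e ^ 2 + 3 * e + (2 * p - 1) = 0 := by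
    rw [eq_ratCast] at hz
    exact_mod_cast hz
  have h3 : (3 : ℚ) ≤ p := by exact_mod_cast hp
  nlinarith [sq_nonneg (2 * e + 3)]

theorem rat_coords_eq {K : Type*} [Field K] [CharZero K] [Algebra ℚ K] {z : K}
    (h : z ∉ (⊥ : IntermediateField ℚ K)) {a b c d : ℚ} (he : (a : K) + b * z = c + d * z) :
    a = c ∧ b = d := by
  have := eq_zero_of_add_mul_eq_zero ⊥ h (s := algebraMap ℚ K (a - c))
    (t := algebraMap ℚ K (b - d)) (IntermediateField.algebraMap_mem _ _)
    (IntermediateField.algebraMap_mem _ _)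
    (by simp only [eq_ratCast]; push_cast; linear_combination he)
  simp only [map_eq_zero] at this
  constructor <;> linarith [this.1, this.2]

theorem int_coords_eq {K : Type*} [Field K] [CharZero K] [Algebra ℚ K] {z : K}
    (h : z ∉ (⊥ : IntermediateField ℚ K)) {a b c d : ℤ} (he : (a : K) + b * z = c + d * z) :
    a = c ∧ b = d := by
  have := rat_coords_eq h (a := a) (b := b) (c := c) (d := d) (by exact_mod_cast he)
  exact_mod_cast this

theorem sq_coords {K : Type*} [Field K] [CharZero K] [Algebra ℚ K] {p : ℕ} (hp : 3 ≤ p) {z : K}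
    (hz : z ^ 2 + 3 * z + (2 * p - 1) = 0) {t : K} (ht : t ∈ ℚ⟮z⟯) {c d : ℚ}
    (h : t ^ 2 = c + d * z) :
    ∃ e f : ℚ, e ^ 2 - (2 * p - 1) * f ^ 2 = c ∧ 2 * e * f - 3 * f ^ 2 = d := by
  obtain ⟨e, f, rfl⟩ := exists_rat_of_mem_adjoin (q := 2 * (p : K) - 1)
    (sub_mem (mul_mem (ofNat_mem _ 2) (IntermediateField.natCast_mem _ p)) (one_mem _)) hz ht
  refine ⟨e, f, rat_coords_eq (notMem_bot_of_quadratic hp hz) ?_⟩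
  push_cast
  linear_combination h - f ^ 2 * hz

theorem sq_norm {K : Type*} [Field K] [CharZero K] [Algebra ℚ K] {p : ℕ} (hp : 3 ≤ p) {z : K}
    (hz : z ^ 2 + 3 * z + (2 * p - 1) = 0) {t : K} (ht : t ∈ ℚ⟮z⟯) {c d : ℚ}
    (h : t ^ 2 = c + d * z) :
    ∃ r : ℚ, r ^ 2 = c ^ 2 - 3 * c * d + (2 * p - 1) * d ^ 2 := by
  obtain ⟨e, f, rfl, rfl⟩ := sq_coords hp hz ht h
  exact ⟨e ^ 2 - 3 * e * f + (2 * p - 1) * f ^ 2, by ring⟩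

theorem exists_rat_sq {K : Type*} [Field K] [CharZero K] [Algebra ℚ K] {p : ℕ} (hp : 3 ≤ p) {z : K}
    (hz : z ^ 2 + 3 * z + (2 * p - 1) = 0) {t : K} (ht : t ∈ ℚ⟮z⟯) {c : ℚ} (hc : 0 < c)
    (h : t ^ 2 = c) :
    ∃ r : ℚ, r ^ 2 = c := by
  obtain ⟨e, f, h1, h2⟩ := sq_coords hp hz ht (c := c) (d := 0) (by simpa using h)
  have h3 : f * (2 * e - 3 * f) = 0 := by linear_combination h2
  rcases mul_eq_zero.1 h3 with rfl | h4
  · exact ⟨e, by linear_combination h1⟩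
  · have h3 : (3 : ℚ) ≤ p := by exact_mod_cast hp
    have : e = 3 / 2 * f := by linarith
    subst this
    nlinarith [sq_nonneg f]

theorem notMem_of_sq_eq {K : Type*} [Field K] [CharZero K] [Algebra ℚ K] {p : ℕ} (hp : 3 ≤ p)
    (hsf : Squarefree ((2 * (p : ℤ) + 9) * (2 * (p : ℤ) - 3) * (8 * (p : ℤ) - 13))) {z : K}
    (hz : z ^ 2 + 3 * z + (2 * p - 1) = 0) {t : K} {i j k l : ℕ} (hi : i < 2) (hj : j < 2)
    (hk : k < 2) (hl : l < 2)
    (h : t ^ 2 = (2 * p - 3) ^ k * (2 * p + 9) ^ l * (z + 2) ^ i * (z - 2) ^ j)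
    (hne : i + j + k + l ≠ 0) : t ∉ ℚ⟮z⟯ := by
  intro ht
  have hAB : Squarefree ((2 * (p : ℤ) + 9) * (2 * (p : ℤ) - 3)) := hsf.of_mul_left
  have hnsq : ∀ m n : ℕ, m < 2 → n < 2 → m + n ≠ 0 →
      ∀ r : ℚ, r ^ 2 ≠ (2 * p - 3) ^ m * (2 * p + 9) ^ n := by
    intro m n hm hn hmn r hr
    have hA : (1 : ℤ) < 2 * p - 3 := by omega
    have hB : (1 : ℤ) < 2 * p + 9 := by omega
    interval_cases m <;> interval_cases n
    · exact hmn rfl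
    · exact hAB.of_mul_left.sq_ne_ratCast hB r (by push_cast; linear_combination hr)
    · exact hAB.of_mul_right.sq_ne_ratCast hA r (by push_cast; linear_combination hr)
    · exact hAB.sq_ne_ratCast (by nlinarith) r (by push_cast; linear_combination hr)
  have h3 : (3 : ℚ) ≤ p := by exact_mod_cast hp
  have hA0 : (0 : ℚ) < 2 * p - 3 := by linarith
  have hB0 : (0 : ℚ) < 2 * p + 9 := by linarith
  set m : ℚ := (2 * p - 3) ^ k * (2 * p + 9) ^ l with hm
  have hm0 : 0 < m := by positivity
  have hmK : ((2 * p - 3) ^ k * (2 * p + 9) ^ l : K) = m := by rw [hm]; push_cast; ring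
  rw [hmK] at h
  interval_cases i <;> interval_cases j
  · obtain ⟨r, hr⟩ := exists_rat_sq hp hz ht hm0 (by simpa using h)
    exact hnsq k l hk hl (by omega) r hr
  · obtain ⟨r, hr⟩ := sq_norm hp hz ht (c := -2 * m) (d := m) (by push_cast; linear_combination h)
    refine hnsq 0 1 (by norm_num) (by norm_num) (by norm_num) (r / m) ?_
    field_simp
    linear_combination hr
  · obtain ⟨r, hr⟩ := sq_norm hp hz ht (c := 2 * m) (d := m) (by push_cast; linear_combination h)
    refine hnsq 1 0 (by norm_num) (by norm_num) (by norm_num) (r / m) ?_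
    field_simp
    linear_combination hr
  · obtain ⟨r, hr⟩ := sq_norm hp hz ht (c := -(2 * p + 3) * m) (d := - 3 * m)
      (by push_cast; linear_combination h + m * hz)
    refine hnsq 1 1 (by norm_num) (by norm_num) (by norm_num) (r / m) ?_
    field_simp
    linear_combination hr

theorem exists_int_of_mem_bot {K : Type*} [Field K] [Algebra ℚ K] {t : K}
    (ht : t ∈ (⊥ : IntermediateField ℚ K)) (hi : IsIntegral ℤ t) : ∃ n : ℤ, t = n := by
  obtain ⟨e, rfl⟩ := mem_bot.1 ht
  rw [isIntegral_algebraMap_iff (algebraMap ℚ K).injective] at hi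
  obtain ⟨n, rfl⟩ := IsIntegrallyClosed.isIntegral_iff.1 hi
  exact ⟨n, by simp⟩

theorem exists_int_coords {K : Type*} [Field K] [CharZero K] [Algebra ℚ K] {p : ℕ} (hp : 3 ≤ p)
    (hsf : Squarefree (8 * (p : ℤ) - 13)) {z : K} (hz : z ^ 2 + 3 * z + (2 * p - 1) = 0) {t : K}
    (ht : t ∈ ℚ⟮z⟯) (hi : IsIntegral ℤ t) : ∃ m n : ℤ, t = m + n * z := by
  rw [← bot_sup_eq ℚ⟮z⟯] at ht
  have hrad : ∀ w ∈ (⊥ : IntermediateField ℚ K), ∀ c ∈ (⊥ : IntermediateField ℚ K), IsIntegral ℤ w →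
      IsIntegral ℤ c → w ^ 2 = ((-3) ^ 2 - 4 * (2 * (p : K) - 1)) * c →
      ∃ c' : K, IsIntegral ℤ c' ∧ w = ((-3) ^ 2 - 4 * (2 * (p : K) - 1)) * c' := by
    intro w hw c hc hwi hci h
    obtain ⟨w, rfl⟩ := exists_int_of_mem_bot hw hwi
    obtain ⟨c, rfl⟩ := exists_int_of_mem_bot hc hci
    have h' : w ^ 2 = (8 * p - 13) * (- c) := by
      have : ((w ^ 2 : ℤ) : K) = ((8 * p - 13) * (- c) : ℤ) := by push_cast; linear_combination h
      exact_mod_cast this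
    obtain ⟨c', rfl⟩ := hsf.isRadical 2 w ⟨_, h'⟩
    exact ⟨((- c' : ℤ) : K), isIntegral_intCast _, by push_cast; ring⟩
  obtain ⟨s, hs, r, hr, hsi, hti, rfl⟩ := exists_integral_coords ⊥ (τ := -3) (n := 2 * (p : K) - 1)
    (notMem_bot_of_quadratic hp hz) (neg_mem (ofNat_mem _ 3))
    (sub_mem (mul_mem (ofNat_mem _ 2) (IntermediateField.natCast_mem _ p)) (one_mem _))
    (by simpa using isIntegral_intCast (R := ℤ) (B := K) (-3))
    (by simpa using isIntegral_intCast (R := ℤ) (B := K) (2 * p - 1)) (by linear_combination hz)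
      hrad ht hi
  obtain ⟨m, rfl⟩ := exists_int_of_mem_bot hs hsi
  obtain ⟨n, rfl⟩ := exists_int_of_mem_bot hr hti
  exact ⟨m, n, rfl⟩

theorem two_dvd_of_mod_four {p s0 s1 t0 t1 n0 n1 : ℤ} (hp : Odd p)
    (h0 : s0 ^ 2 - (2 * p - 1) * s1 ^ 2 - 2 * (t0 ^ 2 - (2 * p - 1) * t1 ^ 2) +
      (2 * p - 1) * (2 * t0 * t1 - 3 * t1 ^ 2) = 4 * n0)
    (h1 : 2 * s0 * s1 - 3 * s1 ^ 2 - (t0 ^ 2 - (2 * p - 1) * t1 ^ 2) -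
      2 * (2 * t0 * t1 - 3 * t1 ^ 2) + 3 * (2 * t0 * t1 - 3 * t1 ^ 2) = 4 * n1) :
    2 ∣ s0 ∧ 2 ∣ s1 ∧ 2 ∣ t0 ∧ 2 ∣ t1 := by
  obtain ⟨k, rfl⟩ := hp
  have key : ∀ a b c d : ZMod 4, a ^ 2 - b ^ 2 - 2 * (c ^ 2 - d ^ 2) + (2 * c * d - 3 * d ^ 2) = 0 →
      2 * a * b - 3 * b ^ 2 - (c ^ 2 - d ^ 2) - 2 * (2 * c * d - 3 * d ^ 2) +
        3 * (2 * c * d - 3 * d ^ 2) = 0 →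
      2 * a = 0 ∧ 2 * b = 0 ∧ 2 * c = 0 ∧ 2 * d = 0 := by decide
  have h4 : (4 : ZMod 4) = 0 := rfl
  have h0' := congrArg (Int.cast : ℤ → ZMod 4) h0
  have h1' := congrArg (Int.cast : ℤ → ZMod 4) h1
  push_cast at h0' h1'
  have even_of : ∀ a : ℤ, 2 * (a : ZMod 4) = 0 → 2 ∣ a := by
    intro a ha
    have : ((2 * a : ℤ) : ZMod 4) = 0 := by push_cast; exact ha
    rw [ZMod.intCast_zmod_eq_zero_iff_dvd] at this
    omega
  obtain ⟨ha, hb, hc, hd⟩ := key s0 s1 t0 t1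
    (by linear_combination h0' + h4 *
      (n0 + k * s1 ^ 2 - 2 * k * t1 ^ 2 - k * (2 * t0 * t1 - 3 * t1 ^ 2)))
    (by linear_combination h1' + h4 * (n1 - k * t1 ^ 2))
  exact ⟨even_of _ ha, even_of _ hb, even_of _ hc, even_of _ hd⟩

theorem dvd_of_intCast_eq_mul {K : Type*} [Field K] [CharZero K] [Algebra ℚ K] {p : ℕ} (hp : 3 ≤ p)
    {z : K} (hz : z ^ 2 + 3 * z + (2 * p - 1) = 0) {m e c0 c1 : ℤ}
    (h : (m : K) = (z + e) * (c0 + c1 * z)) :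
    e ^ 2 - 3 * e + (2 * p - 1) ∣ m := by
  obtain ⟨h1, h2⟩ := int_coords_eq (notMem_bot_of_quadratic hp hz) (a := m) (b := 0)
    (c := e * c0 - (2 * p - 1) * c1) (d := c0 + e * c1 - 3 * c1)
    (by push_cast; linear_combination h + c1 * hz)
  exact ⟨-c1, by linear_combination h1 - e * h2⟩

theorem isIntegral_of_eq_zero {K : Type*} [Field K] {p : ℕ} {z : K}
    (hz : z ^ 2 + 3 * z + (2 * p - 1) = 0) : IsIntegral ℤ z :=
  isIntegral_of_quadratic (τ := -3) (n := 2 * (p : K) - 1)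
    (by simpa using isIntegral_intCast (R := ℤ) (B := K) (-3))
    (by simpa using isIntegral_intCast (R := ℤ) (B := K) (2 * p - 1)) (by linear_combination hz)

theorem exists_eq_add_mul_of_sq_eq {K : Type*} [Field K] [CharZero K] [Algebra ℚ K] {p : ℕ}
    (hp : 3 ≤ p) (hD : Squarefree (8 * (p : ℤ) - 13)) {z : K} (hz : z ^ 2 + 3 * z + (2 * p - 1) = 0)
    {e : ℤ} (he : Squarefree (e ^ 2 - 3 * e + (2 * p - 1))) {w c : K} (hw : w ∈ ℚ⟮z⟯)
    (hc : c ∈ ℚ⟮z⟯) (hwi : IsIntegral ℤ w) (hci : IsIntegral ℤ c) (h : w ^ 2 = (z + e) * c) :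
    ∃ c' : K, IsIntegral ℤ c' ∧ w = (z + e) * c' := by
  obtain ⟨w0, w1, rfl⟩ := exists_int_coords hp hD hz hw hwi
  obtain ⟨c0, c1, rfl⟩ := exists_int_coords hp hD hz hc hci
  have h1 : (((w0 - e * w1) ^ 2 : ℤ) : K) = (z + e) *
    ((c0 - 2 * w1 * (w0 - e * w1) - e * w1 ^ 2 : ℤ) + (c1 - w1 ^ 2 : ℤ) * z) := by
    push_cast
    linear_combination h
  obtain ⟨m, hm⟩ := he.isRadical 2 _ (dvd_of_intCast_eq_mul hp hz h1)
  refine ⟨w1 + (e - 3 - z) * m, ?_, ?_⟩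
  · have h3 := isIntegral_intCast (R := ℤ) (B := K) (e - 3)
    push_cast at h3
    exact (isIntegral_intCast _).add
      ((h3.sub (isIntegral_of_eq_zero hz)).mul (isIntegral_intCast _))
  · have hm' := congrArg (Int.cast : ℤ → K) hm
    push_cast at hm'
    linear_combination hm' + m * hz

theorem exists_int_coords_sqrt {K : Type*} [Field K] [CharZero K] [Algebra ℚ K] {p : ℕ}
    (hp : 3 ≤ p) (hodd : Odd p)
    (hsf : Squarefree ((2 * (p : ℤ) + 9) * (2 * (p : ℤ) - 3) * (8 * (p : ℤ) - 13))) {z : K}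
    (hz : z ^ 2 + 3 * z + (2 * p - 1) = 0) {u : K} (hu : u ^ 2 = z + 2) {α : K}
    (hα : α ∈ ℚ⟮z⟯ ⊔ ℚ⟮u⟯) (hi : IsIntegral ℤ α) :
    ∃ a b c d : ℤ, α = (a + b * z) + (c + d * z) * u := by
  have hzE : z ∈ ℚ⟮z⟯ := mem_adjoin_simple_self ℚ z
  have h2E : (2 : K) ∈ ℚ⟮z⟯ := ofNat_mem _ 2
  have hD := hsf.of_mul_right
  have huE : u ∉ ℚ⟮z⟯ := notMem_of_sq_eq hp hsf hz (i := 1) (j := 0) (k := 0) (l := 0) (by simp)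
    (by simp) (by simp) (by simp) (by simp [hu]) (by simp)
  have h2i : IsIntegral ℤ (2 : K) := by simpa using isIntegral_intCast (R := ℤ) (B := K) 2
  have hai : IsIntegral ℤ (z + 2) := (isIntegral_of_eq_zero hz).add h2i
  have ha0 : z + 2 ≠ 0 := by
    intro h
    apply huE
    rw [← hu, pow_eq_zero_iff two_ne_zero] at h
    rw [h]; exact zero_mem _
  obtain ⟨s, hs, t, ht, rfl⟩ := exists_eq_add_mul_of_mem_sup_adjoin ℚ⟮z⟯ (τ := 0) (n := -(z + 2))
    (zero_mem _) (neg_mem (add_mem hzE h2E)) (by linear_combination hu) hα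
  have hc := isIntegral_conj ℚ⟮z⟯ huE (zero_mem _) (neg_mem (add_mem hzE h2E))
    (by linear_combination hu) hs ht hi
  have h2s : IsIntegral ℤ (2 * s) := by
    rw [show 2 * s = s + t * u + (s + t * (0 - u)) by ring]
    exact hi.add hc
  have hN : IsIntegral ℤ (s ^ 2 - (z + 2) * t ^ 2) := by
    rw [show s ^ 2 - (z + 2) * t ^ 2 = (s + t * u) * (s + t * (0 - u))
      by linear_combination t ^ 2 * hu]
    exact hi.mul hc
  have h2t : IsIntegral ℤ (2 * t) := by
    refine isIntegral_of_sq_mul_of_radical ℚ⟮z⟯.toSubfield (d := z + 2) (add_mem hzE h2E) hai ha0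
      ?_ (mul_mem h2E ht) ?_
    · intro w hw c hc hwi hci h
      have := exists_eq_add_mul_of_sq_eq hp hD hz (e := 2) (by
        rw [show (2 : ℤ) ^ 2 - 3 * 2 + (2 * p - 1) = 2 * p - 3 by ring]
        exact hsf.of_mul_left.of_mul_right) hw hc hwi hci (by push_cast; exact h)
      simpa using this
    · rw [show (2 * t) ^ 2 * (z + 2) = (2 * s) ^ 2 - 2 * 2 * (s ^ 2 - (z + 2) * t ^ 2) by ring]
      exact (h2s.pow 2).sub ((h2i.mul h2i).mul hN)
  obtain ⟨s0, s1, hs'⟩ := exists_int_coords hp hD hz (mul_mem h2E hs) h2s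
  obtain ⟨t0, t1, ht'⟩ := exists_int_coords hp hD hz (mul_mem h2E ht) h2t
  obtain ⟨n0, n1, hn'⟩ := exists_int_coords hp hD hz
    (sub_mem (pow_mem hs 2) (mul_mem (add_mem hzE h2E) (pow_mem ht 2))) hN
  have key : (2 * s) ^ 2 - (z + 2) * (2 * t) ^ 2 = 4 * (n0 + n1 * z) := by rw [← hn']; ring
  rw [hs', ht'] at key
  obtain ⟨k0, k1⟩ := int_coords_eq (notMem_bot_of_quadratic hp hz)
    (a := s0 ^ 2 - (2 * p - 1) * s1 ^ 2 - 2 * (t0 ^ 2 - (2 * p - 1) * t1 ^ 2) + (2 * p - 1) *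
      (2 * t0 * t1 - 3 * t1 ^ 2))
    (b := 2 * s0 * s1 - 3 * s1 ^ 2 - (t0 ^ 2 - (2 * p - 1) * t1 ^ 2) - 2 *
      (2 * t0 * t1 - 3 * t1 ^ 2) + 3 * (2 * t0 * t1 - 3 * t1 ^ 2))
    (c := 4 * n0) (d := 4 * n1)
      (by push_cast; linear_combination key -
      (s1 ^ 2 - 2 * t1 ^ 2 - (2 * t0 * t1 - 3 * t1 ^ 2) - t1 ^ 2 * z) * hz)
  obtain ⟨⟨a, rfl⟩, ⟨b, rfl⟩, ⟨c, rfl⟩, ⟨d, rfl⟩⟩ := two_dvd_of_mod_four (by exact_mod_cast hodd)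
    k0 k1
  refine ⟨a, b, c, d, ?_⟩
  push_cast at hs' ht'
  linear_combination hs' / 2 + ht' / 2 * u

theorem exists_eq_sub_two_mul_of_sq_eq {K : Type*} [Field K] [CharZero K] [Algebra ℚ K] {p : ℕ}
    (hp : 3 ≤ p) (hodd : Odd p)
    (hsf : Squarefree ((2 * (p : ℤ) + 9) * (2 * (p : ℤ) - 3) * (8 * (p : ℤ) - 13))) {z : K}
    (hz : z ^ 2 + 3 * z + (2 * p - 1) = 0) {u : K} (hu : u ^ 2 = z + 2) {w c : K}
    (hw : w ∈ ℚ⟮z⟯ ⊔ ℚ⟮u⟯) (hwi : IsIntegral ℤ w) (hc : c ∈ ℚ⟮z⟯ ⊔ ℚ⟮u⟯) (hci : IsIntegral ℤ c)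
    (h : w ^ 2 = (u - 2) * c) :
    ∃ c' : K, IsIntegral ℤ c' ∧ w = (u - 2) * c' := by
  have hzE : z ∈ ℚ⟮z⟯ := mem_adjoin_simple_self ℚ z
  have huE : u ∉ ℚ⟮z⟯ := notMem_of_sq_eq hp hsf hz (i := 1) (j := 0) (k := 0) (l := 0) (by simp)
    (by simp) (by simp) (by simp) (by simp [hu]) (by simp)
  have hzi := isIntegral_of_eq_zero hz
  have hintegral : ∀ n : ℤ, IsIntegral ℤ (n : K) := fun n => isIntegral_intCast n
  have hui : IsIntegral ℤ u := by
    refine IsIntegral.of_pow (n := 2) (by norm_num) ?_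
    rw [hu]
    exact hzi.add (by simpa using hintegral 2)
  have hmem : ∀ a b : ℤ, (a + b * z : K) ∈ ℚ⟮z⟯ := fun a b => add_mem
    (IntermediateField.intCast_mem _ a) (mul_mem (IntermediateField.intCast_mem _ b) hzE)
  obtain ⟨a, b, k, l, rfl⟩ := exists_int_coords_sqrt hp hodd hsf hz hu hw hwi
  set M : ℤ := a + 2 * b + 2 * k + 4 * l with hM
  obtain ⟨w', hw'⟩ : ∃ w' : K, w' = (2 * b + k + 4 * l : ℤ) + l * z + (b + 2 * l : ℤ) * u :=
    ⟨_, rfl⟩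
  have hwi' : IsIntegral ℤ w' := by
    rw [hw']
    exact ((hintegral _).add ((hintegral _).mul hzi)).add ((hintegral _).mul hui)
  have hMw : (a + b * z + (k + l * z) * u : K) = M + (u - 2) * w' := by
    rw [hw', hM]; push_cast
    linear_combination (- (b : K) - 2 * l) * hu
  rw [hMw] at h
  have hMsq : ∃ t0 t1 : ℤ, ((M ^ 2 : ℤ) : K) = (z + (-2 : ℤ)) * (t0 + t1 * z) := by
    have hle : ℚ⟮z⟯ ≤ ℚ⟮z⟯ ⊔ ℚ⟮u⟯ := le_sup_left
    have huE' : u ∈ ℚ⟮z⟯ ⊔ ℚ⟮u⟯ := (le_sup_right : ℚ⟮u⟯ ≤ _) (mem_adjoin_simple_self ℚ u)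
    have hwE' : w' ∈ ℚ⟮z⟯ ⊔ ℚ⟮u⟯ := by
      rw [hw']
      exact add_mem (hle (hmem _ _)) (mul_mem (IntermediateField.intCast_mem _ _) huE')
    obtain ⟨s0, s1, t0, t1, hC⟩ := exists_int_coords_sqrt hp hodd hsf hz hu
      (α := c - (2 * M : ℤ) * w' - (u - (2 : ℤ)) * w' ^ 2)
      (sub_mem (sub_mem hc (mul_mem (IntermediateField.intCast_mem _ _) hwE'))
        (mul_mem (sub_mem huE' (IntermediateField.intCast_mem _ _)) (pow_mem hwE' 2)))
      ((hci.sub ((hintegral _).mul hwi')).sub ((hui.sub (hintegral _)).mul (hwi'.pow 2)))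
    push_cast at hC
    have hsub : (M : K) ^ 2 = (u - 2) * (s0 + s1 * z + (t0 + t1 * z) * u) := by
      linear_combination h + (u - 2) * hC
    obtain ⟨h1, h2⟩ := eq_zero_of_add_mul_eq_zero ℚ⟮z⟯ huE
      (s := (M : K) ^ 2 - (z + 2) * (t0 + t1 * z) + 2 * (s0 + s1 * z))
      (t := 2 * (t0 + t1 * z) - (s0 + s1 * z))
      (add_mem (sub_mem (pow_mem (IntermediateField.intCast_mem _ _) 2)
        (mul_mem (add_mem hzE (ofNat_mem _ 2)) (hmem _ _))) (mul_mem (ofNat_mem _ 2) (hmem _ _)))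
      (sub_mem (mul_mem (ofNat_mem _ 2) (hmem _ _)) (hmem _ _))
      (by linear_combination hsub + (t0 + t1 * z) * hu)
    refine ⟨t0, t1, ?_⟩
    push_cast
    linear_combination h1 + 2 * h2
  obtain ⟨t0, t1, ht⟩ := hMsq
  have hB : Squarefree ((-2 : ℤ) ^ 2 - 3 * (-2) + (2 * p - 1)) := by
    convert hsf.of_mul_left.of_mul_left using 1
    ring
  obtain ⟨m, hm⟩ := hB.isRadical 2 _ (dvd_of_intCast_eq_mul hp hz ht)
  refine ⟨(u + (2 : ℤ)) * ((-5 : ℤ) - z) * m + w',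
    (((hui.add (hintegral 2)).mul ((hintegral _).sub hzi)).mul (hintegral m)).add hwi', ?_⟩
  rw [hMw, hm]
  push_cast
  linear_combination m * (5 + z) * hu + m * hz

theorem exists_integral_coords_octic {K : Type*} [Field K] [CharZero K] [Algebra ℚ K] {p : ℕ}
    (hp : 3 ≤ p) (hodd : Odd p)
    (hsf : Squarefree ((2 * (p : ℤ) + 9) * (2 * (p : ℤ) - 3) * (8 * (p : ℤ) - 13))) {z : K}
    (hz : z ^ 2 + 3 * z + (2 * p - 1) = 0) {u x : K} (hu : u ^ 2 = z + 2) (hx : x ^ 2 = u * x - 1)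
    (hxE : x ∉ ℚ⟮z⟯ ⊔ ℚ⟮u⟯) {α : K} (hα : α ∈ ℚ⟮z⟯ ⊔ ℚ⟮u⟯ ⊔ ℚ⟮x⟯) (hi : IsIntegral ℤ α) :
    ∃ s ∈ ℚ⟮z⟯ ⊔ ℚ⟮u⟯, ∃ t ∈ ℚ⟮z⟯ ⊔ ℚ⟮u⟯, IsIntegral ℤ s ∧ IsIntegral ℤ t ∧ α = s + t * x := by
  have hzi := isIntegral_of_eq_zero hz
  have hintegral : ∀ n : ℤ, IsIntegral ℤ (n : K) := fun n => isIntegral_intCast n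
  have hui : IsIntegral ℤ u := by
    refine IsIntegral.of_pow (n := 2) (by norm_num) ?_
    rw [hu]
    exact hzi.add (by simpa using hintegral 2)
  have huE : u ∈ ℚ⟮z⟯ ⊔ ℚ⟮u⟯ := (le_sup_right : ℚ⟮u⟯ ≤ _) (mem_adjoin_simple_self ℚ u)
  have hneg : ℚ⟮-u⟯ = ℚ⟮u⟯ := by
    apply le_antisymm <;> rw [adjoin_simple_le_iff]
    · exact neg_mem (mem_adjoin_simple_self ℚ u)
    · simpa using neg_mem (mem_adjoin_simple_self ℚ (-u))
  refine exists_integral_coords _ hxE huE (one_mem _) hui (by simpa using hintegral 1) hx ?_ hα hi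
  intro w hw c hc hwi hci h
  have h2 : (2 : K) ∈ ℚ⟮z⟯ ⊔ ℚ⟮u⟯ := ofNat_mem _ 2
  have h2i : IsIntegral ℤ (2 : K) := by simpa using hintegral 2
  obtain ⟨c₁, hc₁, h₁⟩ := exists_eq_sub_two_mul_of_sq_eq hp hodd hsf hz hu hw hwi
    (mul_mem (add_mem huE h2) hc) ((hui.add h2i).mul hci) (by linear_combination h)
  obtain ⟨c₂, hc₂, h₂⟩ := exists_eq_sub_two_mul_of_sq_eq hp hodd hsf hz (u := -u)
    (by linear_combination hu) (by rwa [hneg]) hwi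
    (by rw [hneg]; exact mul_mem (sub_mem h2 huE) hc) ((h2i.sub hui).mul hci)
    (by linear_combination h)
  obtain ⟨k, hk⟩ := hodd
  refine ⟨(c₁ + c₂) * (k + 3 : ℤ) - w * ((-5 : ℤ) - z), ((hc₁.add hc₂).mul (hintegral _)).sub
    (hwi.mul ((hintegral _).sub hzi)), ?_⟩
  have hk' : (p : K) = 2 * k + 1 := by exact_mod_cast hk
  push_cast
  linear_combination (k + 3) * (u + 2) * h₁ - (k + 3) * (u - 2) * h₂ - w * hz + 2 * w * hk' - w *
    (z + 5) * hu

theorem exists_quadratic_tower {K : Type*} [Field K] {p : ℕ} {x : K}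
    (hx : x ^ 8 + 3 * x ^ 6 + (2 * p + 1) * x ^ 4 + 3 * x ^ 2 + 1 = 0) :
    ∃ z ∈ Algebra.adjoin ℤ {x}, ∃ u ∈ Algebra.adjoin ℤ {x}, z ^ 2 + 3 * z + (2 * p - 1) = 0 ∧
      u ^ 2 = z + 2 ∧ x ^ 2 = u * x - 1 := by
  set i : K := -(x ^ 7 + 3 * x ^ 5 + ((2 * p + 1 : ℤ) : K) * x ^ 3 + ((3 : ℤ) : K) * x) with hi
  have hxi : x * i = 1 := by rw [hi]; push_cast; linear_combination - hx
  have hxS : x ∈ Algebra.adjoin ℤ {x} := Algebra.self_mem_adjoin_singleton ℤ x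
  have hZ : ∀ n : ℤ, (n : K) ∈ Algebra.adjoin ℤ {x} := fun n => intCast_mem _ n
  have hiS : i ∈ Algebra.adjoin ℤ {x} := by
    rw [hi]
    refine neg_mem (add_mem (add_mem (add_mem (pow_mem hxS 7) (mul_mem ?_ (pow_mem hxS 5)))
      (mul_mem (hZ _) (pow_mem hxS 3))) (mul_mem (hZ _) hxS))
    simp
  clear_value i
  refine ⟨x ^ 2 + i ^ 2, add_mem (pow_mem hxS 2) (pow_mem hiS 2), x + i, add_mem hxS hiS, ?_,
    by linear_combination 2 * hxi, by linear_combination -hxi⟩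
  have hx0 : x ^ 4 ≠ 0 := pow_ne_zero _ (left_ne_zero_of_mul_eq_one hxi)
  refine (mul_eq_zero.1 ?_).resolve_left hx0
  have h1 : x ^ 2 * i ^ 2 = 1 := by rw [← mul_pow, hxi, one_pow]
  linear_combination hx + (x ^ 2 * i ^ 2 + 1 + 2 * x ^ 4 + 3 * x ^ 2) * h1

theorem notMem_of_quadratic_tower {K : Type*} [Field K] [CharZero K] [Algebra ℚ K] {p : ℕ}
    (hp : 3 ≤ p) (hsf : Squarefree ((2 * (p : ℤ) + 9) * (2 * (p : ℤ) - 3) * (8 * (p : ℤ) - 13)))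
    {z u x : K} (hz : z ^ 2 + 3 * z + (2 * p - 1) = 0) (hu : u ^ 2 = z + 2)
    (hx : x ^ 2 = u * x - 1) : u ∉ ℚ⟮z⟯ ∧ x ∉ ℚ⟮z⟯ ⊔ ℚ⟮u⟯ := by
  refine ⟨notMem_of_sq_eq hp hsf hz (i := 1) (j := 0) (k := 0) (l := 0) (by simp) (by simp)
    (by simp) (by simp) (by simp [hu]) (by simp), fun h => ?_⟩
  have hzE : z ∈ ℚ⟮z⟯ := mem_adjoin_simple_self ℚ z
  have huE : u ∈ ℚ⟮z⟯ ⊔ ℚ⟮u⟯ := (le_sup_right : ℚ⟮u⟯ ≤ _) (mem_adjoin_simple_self ℚ u)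
  have hv : (2 * x - u) ^ 2 = z - 2 := by linear_combination 4 * hx + hu
  rcases mem_or_mul_mem ℚ⟮z⟯ (x := u) (t := 2 * x - u)
    (by rw [hu]; exact add_mem hzE (ofNat_mem _ 2)) (by rw [hv]; exact sub_mem hzE (ofNat_mem _ 2))
    (sub_mem (mul_mem (ofNat_mem _ 2) h) huE) with h | h
  · exact notMem_of_sq_eq hp hsf hz (i := 0) (j := 1) (k := 0) (l := 0) (by simp) (by simp)
      (by simp) (by simp) (by simp [hv]) (by simp) h
  · exact notMem_of_sq_eq hp hsf hz (i := 1) (j := 1) (k := 0) (l := 0) (by simp) (by simp)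
      (by simp) (by simp) (by simp [hv, hu, mul_pow]) (by simp) h

theorem finrank_adjoin_quadratic {K : Type*} [Field K] [CharZero K] [Algebra ℚ K] {p : ℕ}
    (hp : 3 ≤ p) {z : K} (hz : z ^ 2 + 3 * z + (2 * p - 1) = 0) : Module.finrank ℚ ℚ⟮z⟯ = 2 := by
  have := finrank_sup_adjoin_of_quadratic ⊥ (τ := -3) (n := 2 * (p : K) - 1)
    (neg_mem (ofNat_mem _ 3))
    (sub_mem (mul_mem (ofNat_mem _ 2) (IntermediateField.natCast_mem _ p)) (one_mem _))
      (by linear_combination hz) (notMem_bot_of_quadratic hp hz)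
  rwa [bot_sup_eq, IntermediateField.finrank_bot, mul_one] at this

theorem finrank_quadratic_tower {K : Type*} [Field K] [CharZero K] [Algebra ℚ K] {p : ℕ}
    (hp : 3 ≤ p) (hsf : Squarefree ((2 * (p : ℤ) + 9) * (2 * (p : ℤ) - 3) * (8 * (p : ℤ) - 13)))
    {z u x : K} (hz : z ^ 2 + 3 * z + (2 * p - 1) = 0) (hu : u ^ 2 = z + 2)
    (hx : x ^ 2 = u * x - 1) : Module.finrank ℚ ↥(ℚ⟮z⟯ ⊔ ℚ⟮u⟯ ⊔ ℚ⟮x⟯) = 8 := by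
  have hzE : z ∈ ℚ⟮z⟯ := mem_adjoin_simple_self ℚ z
  have huE : u ∈ ℚ⟮z⟯ ⊔ ℚ⟮u⟯ := (le_sup_right : ℚ⟮u⟯ ≤ _) (mem_adjoin_simple_self ℚ u)
  obtain ⟨h1, h2⟩ := notMem_of_quadratic_tower hp hsf hz hu hx
  rw [finrank_sup_adjoin_of_quadratic _ huE (one_mem _) hx h2, finrank_sup_adjoin_of_quadratic _
    (zero_mem _) (n := -(z + 2)) (neg_mem (add_mem hzE (ofNat_mem _ 2))) (by linear_combination hu)
    h1, finrank_adjoin_quadratic hp hz]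

theorem sup_adjoin_eq_of_mem_adjoin_int {K : Type*} [Field K] [Algebra ℚ K] {z u x : K}
    (hz : z ∈ Algebra.adjoin ℤ {x}) (hu : u ∈ Algebra.adjoin ℤ {x}) :
    ℚ⟮z⟯ ⊔ ℚ⟮u⟯ ⊔ ℚ⟮x⟯ = ℚ⟮x⟯ := by
  have key : ∀ y ∈ Algebra.adjoin ℤ {x}, y ∈ ℚ⟮x⟯ := by
    intro y hy
    induction hy using Algebra.adjoin_induction with
    | mem y hy => rw [Set.mem_singleton_iff.1 hy]; exact mem_adjoin_simple_self ℚ x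
    | algebraMap r => simp
    | add _ _ _ _ h1 h2 => exact add_mem h1 h2
    | mul _ _ _ _ h1 h2 => exact mul_mem h1 h2
  rw [sup_eq_right, sup_le_iff, adjoin_simple_le_iff, adjoin_simple_le_iff]
  exact ⟨key z hz, key u hu⟩

theorem aeval_octic {R : Type*} [CommRing R] [Algebra ℤ R] (p : ℕ) (x : R) :
    aeval x (X ^ 8 + 3 * X ^ 6 + C (2 * (p : ℤ) + 1) * X ^ 4 + 3 * X ^ 2 + 1 : ℤ[X]) =
      x ^ 8 + 3 * x ^ 6 + (2 * p + 1) * x ^ 4 + 3 * x ^ 2 + 1 := by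
  simp [aeval_def, eval₂_add, eval₂_mul]

theorem isMonogenic_octic {p : ℕ} (hp : 3 ≤ p) (hodd : Odd p)
    (hsf : Squarefree ((2 * (p : ℤ) + 9) * (2 * (p : ℤ) - 3) * (8 * (p : ℤ) - 13))) :
    IsMonogenic (X ^ 8 + 3 * X ^ 6 + C (2 * (p : ℤ) + 1) * X ^ 4 + 3 * X ^ 2 + 1) := by
  set f : ℤ[X] := X ^ 8 + 3 * X ^ 6 + C (2 * (p : ℤ) + 1) * X ^ 4 + 3 * X ^ 2 + 1 with hf
  have hdeg : f.natDegree = 8 := by rw [hf]; compute_degree!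
  have hmonic : f.Monic := by rw [hf]; monicity!
  refine ⟨hmonic, ?_, ?_⟩
  · set g := f.map (Int.castRingHom ℚ) with hg
    have hgm : g.Monic := hmonic.map _
    have hgd : g.natDegree = 8 := by rw [hg, hmonic.natDegree_map, hdeg]
    obtain ⟨x, hx⟩ := IsAlgClosed.exists_aeval_eq_zero (AlgebraicClosure ℚ) g
      (by rw [degree_eq_natDegree hgm.ne_zero, hgd]; norm_num)
    have hx' : aeval x f = 0 := by
      rw [← hx, hg]
      exact (aeval_map_algebraMap ℚ x f).symm
    rw [hf, aeval_octic] at hx'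
    obtain ⟨z, hzS, u, huS, hz, hu, hxu⟩ := exists_quadratic_tower hx'
    have hfin := finrank_quadratic_tower hp hsf hz hu hxu
    have hintegral : IsIntegral ℚ x := ⟨g, hgm, hx⟩
    rw [sup_adjoin_eq_of_mem_adjoin_int hzS huS, adjoin.finrank hintegral] at hfin
    have := eq_of_monic_of_dvd_of_natDegree_le (minpoly.monic hintegral) hgm (minpoly.dvd ℚ x hx)
      (by rw [hgd, hfin])
    rw [this]
    exact minpoly.irreducible hintegral
  · intro K _ _ θ hθ htop
    apply le_antisymm
    · rw [Algebra.adjoin_le_iff, Set.singleton_subset_iff]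
      exact ⟨f, hmonic, hθ⟩
    · intro α hα
      rw [hf, aeval_octic] at hθ
      obtain ⟨z, hzS, u, huS, hz, hu, hxu⟩ := exists_quadratic_tower hθ
      have htop' : α ∈ ℚ⟮z⟯ ⊔ ℚ⟮u⟯ ⊔ ℚ⟮θ⟯ := by
        rw [sup_adjoin_eq_of_mem_adjoin_int hzS huS]
        exact algebra_adjoin_le_adjoin ℚ {θ} (by rw [htop]; trivial)
      obtain ⟨s, hs, t, ht, hsi, hti, rfl⟩ := exists_integral_coords_octic hp hodd hsf hz hu hxu
        (notMem_of_quadratic_tower hp hsf hz hu hxu).2 htop' hα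
      have key : ∀ s ∈ ℚ⟮z⟯ ⊔ ℚ⟮u⟯, IsIntegral ℤ s → s ∈ Algebra.adjoin ℤ {θ} := by
        intro s hs hsi
        obtain ⟨a, b, c, d, rfl⟩ := exists_int_coords_sqrt hp hodd hsf hz hu hs hsi
        have hZ : ∀ n : ℤ, (n : K) ∈ Algebra.adjoin ℤ {θ} := fun n => _root_.intCast_mem _ n
        exact add_mem (add_mem (hZ a) (mul_mem (hZ b) hzS))
          (mul_mem (add_mem (hZ c) (mul_mem (hZ d) hzS)) huS)
      exact add_mem (key s hs hsi) (mul_mem (key t ht hti) (Algebra.self_mem_adjoin_singleton ℤ θ))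

/-- The action of `ℤ/2` on `KleinFour × KleinFour` that swaps the two factors. -/
def swapHom : Multiplicative (ZMod 2) →* MulAut (KleinFour × KleinFour) where
  toFun g := if g = 1 then 1 else MulEquiv.prodComm
  map_one' := by simp
  map_mul' := by
    intro a b
    ext x : 1
    revert a b x
    decide

theorem swapHom_ofAdd_one : swapHom (Multiplicative.ofAdd 1) = MulEquiv.prodComm := rfl

/-- The family on `ℤ/2` with values `a` at the identity and `b` elsewhere. -/
def pairFamily {α : Type*} (a b : α) (i : Multiplicative (ZMod 2)) : α := if i = 1 then a else b

theorem pairFamily_mul {M : Type*} [Mul M] (a b c d : M) (i : Multiplicative (ZMod 2)) :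
    pairFamily (a * b) (c * d) i = pairFamily a c i * pairFamily b d i := by
  unfold pairFamily
  split_ifs <;> rfl

theorem pairFamily_swapHom (n : KleinFour × KleinFour) (s i : Multiplicative (ZMod 2)) :
    pairFamily (swapHom s n).1 (swapHom s n).2 (s * i) = pairFamily n.1 n.2 i := by
  revert n s i
  decide

/-- The sign `±1` attached to an element of `ℤ/2`. -/
def signOf (L : Type*) [Field L] (i : Multiplicative (ZMod 2)) : L := if i = 1 then 1 else -1

theorem signOf_mul (L : Type*) [Field L] (i j : Multiplicative (ZMod 2)) :
    signOf L (i * j) = signOf L i * signOf L j := by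
  have h : ∀ i : Multiplicative (ZMod 2), i = 1 ∨ i = Multiplicative.ofAdd 1 := by decide
  have h1 : Multiplicative.ofAdd (1 : ZMod 2) ≠ 1 := by decide
  have h2 : Multiplicative.ofAdd (1 : ZMod 2) * Multiplicative.ofAdd 1 = 1 := by decide
  rcases h i with rfl | rfl <;> rcases h j with rfl | rfl <;> simp [signOf, h1, h2]

theorem signOf_injective (L : Type*) [Field L] [CharZero L] : Function.Injective (signOf L) := by
  have h : ∀ i : Multiplicative (ZMod 2), i = 1 ∨ i = Multiplicative.ofAdd 1 := by decide
  have h1 : Multiplicative.ofAdd (1 : ZMod 2) ≠ 1 := by decide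
  have h2 : (-1 : L) ≠ 1 := by norm_num
  intro i j hij
  rcases h i with rfl | rfl <;> rcases h j with rfl | rfl
  · rfl
  · exact absurd hij (by simpa [signOf, h1] using h2.symm)
  · exact absurd hij (by simpa [signOf, h1] using h2)
  · rfl

theorem exists_signOf_of_sq_eq {L : Type*} [Field L] {a b : L} (h : a ^ 2 = b ^ 2) :
    ∃ i, a = signOf L i * b := by
  rcases sq_eq_sq_iff_eq_or_eq_neg.1 h with h | h
  · exact ⟨1, by simp [signOf, h]⟩
  · exact ⟨Multiplicative.ofAdd 1, by simp [signOf, h]⟩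

theorem map_signOf {L : Type*} [Field L] [Algebra ℚ L] (σ : L ≃ₐ[ℚ] L)
    (i : Multiplicative (ZMod 2)) : σ (signOf L i) = signOf L i := by
  unfold signOf
  split_ifs <;> simp

section

variable {L : Type*} [Field L] [Algebra ℚ L]

/-- `σ` permutes the families `Z`, `U`, `V` (the last two up to sign) in the way described
  by `w`. -/
def ActsAs (Z U V : Multiplicative (ZMod 2) → L) (σ : L ≃ₐ[ℚ] L)
    (w : (KleinFour × KleinFour) ⋊[swapHom] Multiplicative (ZMod 2)) : Prop :=
  ∀ i, σ (Z i) = Z (w.right * i) ∧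
    σ (U i) = signOf L (pairFamily w.left.1 w.left.2 (w.right * i)).1 * U (w.right * i) ∧
    σ (V i) = signOf L (pairFamily w.left.1 w.left.2 (w.right * i)).2 * V (w.right * i)

variable {Z U V : Multiplicative (ZMod 2) → L}

theorem ActsAs.mul {σ τ w w'} (h : ActsAs Z U V σ w) (h' : ActsAs Z U V τ w') :
    ActsAs Z U V (σ * τ) (w * w') := by
  intro i
  obtain ⟨h1, h2, h3⟩ := h' i
  obtain ⟨k1, k2, k3⟩ := h (w'.right * i)
  have hp : pairFamily (w * w').left.1 (w * w').left.2 (w.right * (w'.right * i)) =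
      pairFamily w.left.1 w.left.2 (w.right * (w'.right * i)) *
        pairFamily w'.left.1 w'.left.2 (w'.right * i) := by
    rw [SemidirectProduct.mul_left, Prod.fst_mul, Prod.snd_mul, pairFamily_mul, pairFamily_swapHom]
  rw [SemidirectProduct.mul_right, mul_assoc, hp]
  simp only [AlgEquiv.mul_apply, h1, h2, h3, k1, k2, k3, map_mul, map_signOf, Prod.fst_mul,
    Prod.snd_mul, signOf_mul]
  refine ⟨trivial, by ring, by ring⟩

theorem ActsAs.unique [CharZero L] (hZ : Function.Injective Z) (hU : ∀ i, U i ≠ 0)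
    (hV : ∀ i, V i ≠ 0) {σ w w'} (h : ActsAs Z U V σ w) (h' : ActsAs Z U V σ w') : w = w' := by
  have hr : w.right = w'.right := by simpa using hZ ((h 1).1.symm.trans (h' 1).1)
  have hp : ∀ j, pairFamily w.left.1 w.left.2 j = pairFamily w'.left.1 w'.left.2 j := by
    intro j
    obtain ⟨-, k2, k3⟩ := h (w.right⁻¹ * j)
    obtain ⟨-, l2, l3⟩ := h' (w.right⁻¹ * j)
    rw [← hr] at l2 l3
    rw [mul_inv_cancel_left] at k2 k3 l2 l3
    exact Prod.ext (signOf_injective L (mul_right_cancel₀ (hU j) (k2.symm.trans l2)))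
      (signOf_injective L (mul_right_cancel₀ (hV j) (k3.symm.trans l3)))
  exact SemidirectProduct.ext (Prod.ext (hp 1) (hp (Multiplicative.ofAdd 1))) hr

theorem exists_actsAs (hU : ∀ i, U i ^ 2 = Z i + 2) (hV : ∀ i, V i ^ 2 = Z i - 2) (σ : L ≃ₐ[ℚ] L)
    {s : Multiplicative (ZMod 2)} (hs : ∀ i, σ (Z i) = Z (s * i)) : ∃ w, ActsAs Z U V σ w := by
  have hu : ∀ j, ∃ e, σ (U (s⁻¹ * j)) = signOf L e * U j := fun j => exists_signOf_of_sq_eq (by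
    rw [← map_pow, hU, hU, map_add, hs, mul_inv_cancel_left, map_ofNat])
  have hv : ∀ j, ∃ e, σ (V (s⁻¹ * j)) = signOf L e * V j := fun j => exists_signOf_of_sq_eq (by
    rw [← map_pow, hV, hV, map_sub, hs, mul_inv_cancel_left, map_ofNat])
  choose e he using hu
  choose f hf using hv
  let g : Multiplicative (ZMod 2) := Multiplicative.ofAdd 1
  refine ⟨⟨((e 1, f 1), (e g, f g)), s⟩, fun i => ?_⟩
  have hp : ∀ j, pairFamily (e 1, f 1) (e g, f g) j = (e j, f j) := by
    intro j
    have h : ∀ j : Multiplicative (ZMod 2), j = 1 ∨ j = g := by decide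
    have h1 : g ≠ 1 := by decide
    rcases h j with rfl | rfl <;> simp [pairFamily, h1]
  have h1 := he (s * i)
  have h2 := hf (s * i)
  rw [inv_mul_cancel_left] at h1 h2
  exact ⟨hs i, by simpa [hp] using h1, by simpa [hp] using h2⟩

theorem nonempty_mulEquiv_wreath [CharZero L] (hZ : Function.Injective Z) (hU0 : ∀ i, U i ≠ 0)
    (hV0 : ∀ i, V i ≠ 0)
    (hU : ∀ i, U i ^ 2 = Z i + 2) (hV : ∀ i, V i ^ 2 = Z i - 2)
    (hs : ∀ σ : L ≃ₐ[ℚ] L, ∃ s, ∀ i, σ (Z i) = Z (s * i))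
    (hgen : ∀ σ τ : L ≃ₐ[ℚ] L, (∀ i, σ (U i) = τ (U i)) → (∀ i, σ (V i) = τ (V i)) → σ = τ)
    (hcard : Nat.card (L ≃ₐ[ℚ] L) = 32) :
    Nonempty ((L ≃ₐ[ℚ] L) ≃* (KleinFour × KleinFour) ⋊[swapHom] Multiplicative (ZMod 2)) := by
  have hex : ∀ σ : L ≃ₐ[ℚ] L, ∃ w, ActsAs Z U V σ w := fun σ =>
    let ⟨s, h⟩ := hs σ
    exists_actsAs hU hV σ h
  choose w hw using hex
  let f : (L ≃ₐ[ℚ] L) →* (KleinFour × KleinFour) ⋊[swapHom] Multiplicative (ZMod 2) :=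
    MonoidHom.mk' w fun σ τ => (hw (σ * τ)).unique hZ hU0 hV0 ((hw σ).mul (hw τ))
  have hinj : Function.Injective f := by
    intro σ τ h
    have h' : w σ = w τ := h
    have h1 := hw σ
    rw [h'] at h1
    exact hgen σ τ (fun i => (h1 i).2.1.trans (hw τ i).2.1.symm)
      (fun i => (h1 i).2.2.trans (hw τ i).2.2.symm)
  have hcard' : Nat.card ((KleinFour × KleinFour) ⋊[swapHom] Multiplicative (ZMod 2)) = 32 := by
    rw [SemidirectProduct.card]
    simp
  have : Finite ((KleinFour × KleinFour) ⋊[swapHom] Multiplicative (ZMod 2)) :=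
    Nat.finite_of_card_ne_zero (by rw [hcard']; norm_num)
  exact ⟨MulEquiv.ofBijective f
    ((Nat.bijective_iff_injective_and_card f).2 ⟨hinj, hcard.trans hcard'.symm⟩)⟩

end

theorem List.Sublist.exists_pow_mul_prod {M : Type*} [Monoid M] {a : M} {l l' : List M}
    (h : l'.Sublist (a :: l)) :
    ∃ k < 2, ∃ r : List M, r.Sublist l ∧ l'.prod = a ^ k * r.prod ∧ l'.length = k + r.length := by
  rcases List.sublist_cons_iff.1 h with hr | ⟨r, rfl, hr⟩
  · exact ⟨0, by norm_num, l', hr, by simp, by simp⟩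
  · exact ⟨1, by norm_num, r, hr, by simp, by simp [add_comm]⟩

section

variable {L : Type*} [Field L] [Algebra ℚ L]

theorem mem_of_biquadratic [CharZero L] (S : Subalgebra ℚ L) {z u v r : L} (hu : u ^ 2 = z + 2)
    (hv : v ^ 2 = z - 2) (huS : u ∈ S) (hvS : v ∈ S) (hr : r ^ 4 - z * r ^ 2 + 1 = 0) : r ∈ S := by
  have half : ∀ {y : L}, y ∈ S → (1 / 2) * y ∈ S := by
    intro y hy
    have : (1 / 2 : L) = algebraMap ℚ L (1 / 2) := by simp
    rw [this]
    exact mul_mem (S.algebraMap_mem _) hy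
  have key : (r - 1 / 2 * (u + v)) * (r - 1 / 2 * (u - v)) *
    ((r - 1 / 2 * (-u - v)) * (r - 1 / 2 * (-u + v))) = 0 := by
    have h1 : (r - 1 / 2 * (u + v)) * (r - 1 / 2 * (u - v)) = r ^ 2 - r * u + 1 :=
      by linear_combination (hu - hv) / 4
    have h2 : (r - 1 / 2 * (-u - v)) * (r - 1 / 2 * (-u + v)) = r ^ 2 + r * u + 1 :=
      by linear_combination (hu - hv) / 4
    rw [h1, h2]
    linear_combination hr - r ^ 2 * hu
  simp only [mul_eq_zero, sub_eq_zero] at key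
  rcases key with (h | h) | (h | h) <;> rw [h] <;> apply half
  · exact add_mem huS hvS
  · exact sub_mem huS hvS
  · exact sub_mem (neg_mem huS) hvS
  · exact add_mem (neg_mem huS) hvS

theorem finrank_sup_adjoin_sqrts [CharZero L] {p : ℕ} (hp : 3 ≤ p)
    (hsf : Squarefree ((2 * (p : ℤ) + 9) * (2 * (p : ℤ) - 3) * (8 * (p : ℤ) - 13)))
    {z u v u' v' : L} (hz : z ^ 2 + 3 * z + (2 * p - 1) = 0) (hu : u ^ 2 = z + 2)
    (hv : v ^ 2 = z - 2) (hu' : u' ^ 2 = (-3 - z) + 2) (hv' : v' ^ 2 = (-3 - z) - 2) :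
    Module.finrank ℚ ↥(ℚ⟮z⟯ ⊔ adjoin ℚ {x | x ∈ [u * u', v * v', u, v]}) = 32 := by
  have hzE : z ∈ ℚ⟮z⟯ := mem_adjoin_simple_self ℚ z
  have hA : (u * u') ^ 2 = 2 * p - 3 := by rw [mul_pow, hu, hu']; linear_combination - hz
  have hB : (v * v') ^ 2 = 2 * p + 9 := by rw [mul_pow, hv, hv']; linear_combination - hz
  rw [finrank_sup_adjoin_list, finrank_adjoin_quadratic hp hz]
  · rfl
  · have h2 : (2 : L) ∈ ℚ⟮z⟯ := ofNat_mem _ 2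
    have hpE : (p : L) ∈ ℚ⟮z⟯ := IntermediateField.natCast_mem _ p
    intro x hx
    simp only [List.mem_cons, List.not_mem_nil, or_false] at hx
    rcases hx with rfl | rfl | rfl | rfl
    · rw [hA]; exact sub_mem (mul_mem h2 hpE) (ofNat_mem _ 3)
    · rw [hB]; exact add_mem (mul_mem h2 hpE) (ofNat_mem _ 9)
    · rw [hu]; exact add_mem hzE h2
    · rw [hv]; exact sub_mem hzE h2
  · intro l hl hne
    obtain ⟨k, hk, l₁, hl₁, hp₁, hn₁⟩ := hl.exists_pow_mul_prod
    obtain ⟨m, hm, l₂, hl₂, hp₂, hn₂⟩ := hl₁.exists_pow_mul_prod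
    obtain ⟨i, hi, l₃, hl₃, hp₃, hn₃⟩ := hl₂.exists_pow_mul_prod
    obtain ⟨j, hj, l₄, hl₄, hp₄, hn₄⟩ := hl₃.exists_pow_mul_prod
    rw [List.sublist_nil] at hl₄
    subst hl₄
    have hlen := List.length_pos_iff.2 hne
    rw [hp₁, hp₂, hp₃, hp₄, List.prod_nil, mul_one]
    refine notMem_of_sq_eq hp hsf hz hi hj hk hm ?_ (by simp at hn₄; omega)
    rw [← hA, ← hB, ← hu, ← hv]
    ring

theorem nonempty_algEquiv_mulEquiv [CharZero L] {p : ℕ} (hp : 3 ≤ p)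
    (hsf : Squarefree ((2 * (p : ℤ) + 9) * (2 * (p : ℤ) - 3) * (8 * (p : ℤ) - 13))) {g : ℚ[X]}
    (hg : g = (X ^ 8 + 3 * X ^ 6 + C (2 * (p : ℤ) + 1) * X ^ 4 + 3 * X ^ 2 + 1 : ℤ[X]).map
      (Int.castRingHom ℚ))
    (hirr : Irreducible g) [IsSplittingField ℚ L g] :
    Nonempty ((L ≃ₐ[ℚ] L) ≃* (KleinFour × KleinFour) ⋊[swapHom] Multiplicative (ZMod 2)) := by
  have hspl : (g.map (algebraMap ℚ L)).Splits := IsSplittingField.splits L g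
  have hroot : ∀ x : L, eval x (g.map (algebraMap ℚ L)) =
      x ^ 8 + 3 * x ^ 6 + (2 * p + 1) * x ^ 4 + 3 * x ^ 2 + 1 := by
    intro x
    rw [← aeval_octic, eval_map_algebraMap, hg]
    exact aeval_map_algebraMap ℚ x _
  have hdeg : (g.map (algebraMap ℚ L)).degree ≠ 0 := by
    rw [degree_map]
    exact (degree_pos_of_irreducible hirr).ne'
  obtain ⟨x, hx⟩ := hspl.exists_eval_eq_zero hdeg
  rw [hroot] at hx
  obtain ⟨z, -, u, -, hz, hu, hxu⟩ := exists_quadratic_tower hx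
  have hfac_root : ∀ r : L, (r ^ 4 - z * r ^ 2 + 1) * (r ^ 4 - (-3 - z) * r ^ 2 + 1) =
      r ^ 8 + 3 * r ^ 6 + (2 * p + 1) * r ^ 4 + 3 * r ^ 2 + 1 := by
    intro r
    linear_combination -r ^ 4 * hz
  have hfac : g.map (algebraMap ℚ L) =
      (X ^ 4 - C z * X ^ 2 + 1) * (X ^ 4 - C (-3 - z) * X ^ 2 + 1) := by
    refine Polynomial.funext fun r => ?_
    rw [hroot, ← hfac_root]
    simp
  obtain ⟨y, hy⟩ := (hspl.of_dvd
    (by rw [Polynomial.map_ne_zero_iff (algebraMap ℚ L).injective]; exact hirr.ne_zero)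
    (Dvd.intro_left _ hfac.symm)).exists_eval_eq_zero
    (by rw [show (X ^ 4 - C (-3 - z) * X ^ 2 + 1 : L[X]).degree = 4 by compute_degree!]; norm_num)
  replace hy : y ^ 4 - (-3 - z) * y ^ 2 + 1 = 0 := by simpa using hy
  have hy0 : y ≠ 0 := by rintro rfl; norm_num at hy
  obtain ⟨v, hv⟩ : ∃ v, v = 2 * x - u := ⟨_, rfl⟩
  replace hv : v ^ 2 = z - 2 := by rw [hv]; linear_combination 4 * hxu + hu
  obtain ⟨u', hu'⟩ : ∃ u' : L, u' ^ 2 = (-3 - z) + 2 :=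
    ⟨y + y⁻¹, by field_simp; linear_combination hy⟩
  obtain ⟨v', hv'⟩ : ∃ v' : L, v' ^ 2 = (-3 - z) - 2 :=
    ⟨y - y⁻¹, by field_simp; linear_combination hy⟩
  have hA : (u * u') ^ 2 = 2 * p - 3 := by rw [mul_pow, hu, hu']; linear_combination - hz
  have hB : (v * v') ^ 2 = 2 * p + 9 := by rw [mul_pow, hv, hv']; linear_combination - hz
  have hA0 : u * u' ≠ 0 := by
    intro h
    rw [h] at hA
    have : (2 * p : L) = 3 := by linear_combination -hA
    have : 2 * p = 3 := by exact_mod_cast this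
    omega
  have hB0 : v * v' ≠ 0 := by
    intro h
    rw [h] at hB
    have : (2 * p + 9 : L) = 0 := by linear_combination -hB
    have : 2 * p + 9 = 0 := by exact_mod_cast this
    omega
  have mem_top : ∀ S : Subalgebra ℚ L, u ∈ S → v ∈ S → u' ∈ S → v' ∈ S → S = ⊤ := by
    intro S h1 h2 h3 h4
    rw [eq_top_iff, ← IsSplittingField.adjoin_rootSet L g, Algebra.adjoin_le_iff]
    intro r hr
    have hr0 := (mem_rootSet.1 hr).2
    rw [← eval_map_algebraMap, hroot, ← hfac_root] at hr0
    rcases mul_eq_zero.1 hr0 with h | h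
    · exact mem_of_biquadratic S hu hv h1 h2 h
    · exact mem_of_biquadratic S hu' hv' h3 h4 h
  have hfin : Module.finrank ℚ L = 32 := by
    rw [← finrank_sup_adjoin_sqrts hp hsf hz hu hv hu' hv', ← IntermediateField.finrank_top'
      (F := ℚ) (E := L)]
    set E := ℚ⟮z⟯ ⊔ adjoin ℚ {x | x ∈ [u * u', v * v', u, v]} with hE
    have hmem : ∀ t ∈ [u * u', v * v', u, v], t ∈ E := fun t ht =>
      (le_sup_right : _ ≤ E) (subset_adjoin ℚ _ ht)
    have h1 : u ∈ E := hmem u (by simp)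
    have h2 : v ∈ E := hmem v (by simp)
    have h3 : u' ∈ E := by
      rw [← mul_div_cancel_left₀ u' (left_ne_zero_of_mul hA0)]
      exact div_mem (hmem _ (by simp)) h1
    have h4 : v' ∈ E := by
      rw [← mul_div_cancel_left₀ v' (left_ne_zero_of_mul hB0)]
      exact div_mem (hmem _ (by simp)) h2
    have : E = ⊤ := toSubalgebra_injective
      (by rw [mem_top E.toSubalgebra h1 h2 h3 h4, top_toSubalgebra])
    rw [this]
  have hcard : Nat.card (L ≃ₐ[ℚ] L) = 32 := by
    have := IsSplittingField.finiteDimensional L g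
    have := IsGalois.of_separable_splitting_field (E := L) hirr.separable
    rw [IsGalois.card_aut_eq_finrank, hfin]
  have hC2 : ∀ i : Multiplicative (ZMod 2), i = 1 ∨ i = Multiplicative.ofAdd 1 := by decide
  have h1 : Multiplicative.ofAdd (1 : ZMod 2) ≠ 1 := by decide
  have h2 : Multiplicative.ofAdd (1 : ZMod 2) * Multiplicative.ofAdd 1 = 1 := by decide
  have hZne : z ≠ -3 - z := by
    intro h
    apply notMem_bot_of_quadratic hp hz
    rw [show z = algebraMap ℚ L (-3 / 2) by simp; linear_combination h / 2]
    exact IntermediateField.algebraMap_mem _ _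
  have forall_pair : ∀ {P : Multiplicative (ZMod 2) → Prop}, P 1 → P (Multiplicative.ofAdd 1) →
    ∀ i, P i := by
    intro P ha hb i
    rcases hC2 i with rfl | rfl <;> assumption
  refine nonempty_mulEquiv_wreath (L := L) (Z := pairFamily z (-3 - z)) (U := pairFamily u u')
    (V := pairFamily v v') ?_ ?_ ?_ ?_ ?_ ?_ ?_ hcard
  · intro i j hij
    rcases hC2 i with rfl | rfl <;> rcases hC2 j with rfl | rfl
    · rfl
    · exact absurd hij hZne
    · exact absurd hij hZne.symm
    · rfl
  · exact forall_pair (left_ne_zero_of_mul hA0) (right_ne_zero_of_mul hA0)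
  · exact forall_pair (left_ne_zero_of_mul hB0) (right_ne_zero_of_mul hB0)
  · exact forall_pair hu hu'
  · exact forall_pair hv hv'
  · intro σ
    have hσ : (σ z - z) * (σ z - (-3 - z)) = 0 := by
      have := congrArg σ hz
      simp only [map_add, map_mul, map_sub, map_pow, map_ofNat, map_natCast, map_one,
        map_zero] at this
      linear_combination this - hz
    rcases mul_eq_zero.1 hσ with h | h <;> rw [sub_eq_zero] at h
    · exact ⟨1, forall_pair (by simpa [pairFamily] using h) (by simp [pairFamily, h, map_ofNat])⟩
    · exact ⟨Multiplicative.ofAdd 1, forall_pair (by simpa [pairFamily] using h)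
        (by simp [pairFamily, h2, h, map_ofNat])⟩
  · intro σ τ hU hV
    have := mem_top (AlgHom.equalizer (σ : L →ₐ[ℚ] L) τ) (hU 1) (hV 1)
      (hU (Multiplicative.ofAdd 1)) (hV (Multiplicative.ofAdd 1))
    ext t
    have ht : t ∈ AlgHom.equalizer (σ : L →ₐ[ℚ] L) τ := by rw [this]; trivial
    exact ht

end

end

theorem stmt_19 (p : ℕ) (hp : p.Prime) (hp3 : 3 ≤ p)
    (hsf : Squarefree ((2 * (p : ℤ) + 9) * (2 * (p : ℤ) - 3) * (8 * (p : ℤ) - 13))) :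
    IsMonogenic (X ^ 8 + 3 * X ^ 6 + C (2 * (p : ℤ) + 1) * X ^ 4 + 3 * X ^ 2 + 1) ∧
      ∃ φ : Multiplicative (ZMod 2) →* MulAut (KleinFour × KleinFour),
        φ (Multiplicative.ofAdd 1) = (MulEquiv.prodComm : KleinFour × KleinFour ≃* KleinFour × KleinFour) ∧
        Nonempty ((((X ^ 8 + 3 * X ^ 6 + C (2 * (p : ℤ) + 1) * X ^ 4 + 3 * X ^ 2 + 1 :
          Polynomial ℤ).map (Int.castRingHom ℚ)).Gal ≃*
          (KleinFour × KleinFour) ⋊[φ] Multiplicative (ZMod 2))) := by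
  have hmono := isMonogenic_octic hp3 (hp.odd_of_ne_two (by omega)) hsf
  exact ⟨hmono, swapHom, swapHom_ofAdd_one, nonempty_algEquiv_mulEquiv hp3 hsf rfl hmono.2.1⟩
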